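/- Let C be a category with finitely many objects and finitely many morphisms. Then C divides some finite commutative monoid M satisfying m·m = m for all m ∈ M if and only if for every object x of C the endomorphism monoid Hom(x,x) is idempotent and commutative, i.e. f ≫ f = f and f ≫ g = g ≫ f for all endomorphisms f,g : x → x. -/

import Mathlib

open CategoryTheory

namespace SimonThm

universe v u

abbrev Edge (C : Type u) [Category.{v} C] := Σ x y : C, (x ⟶ y)

inductive R {C : Type u} [Category.{v} C] : Set (Edge C) → ∀ a b : C, (a ⟶ b) → Prop
  | nil (a : C) : R ∅ a a (𝟙 a)
  | cons {a b c : C} (S : Set (Edge C)) (e : a ⟶ b) (f : b ⟶ c) (h : R S b c f) :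
      R (insert ⟨a, b, e⟩ S) a c (e ≫ f)

variable {C : Type u} [Category.{v} C]

theorem R.single {a b : C} (e : a ⟶ b) : R {⟨a, b, e⟩} a b e := by
  have := R.cons ∅ e (𝟙 b) (R.nil b)
  simpa using this

theorem R.comp {S T : Set (Edge C)} {a b c : C} {f : a ⟶ b} {g : b ⟶ c}
    (hf : R S a b f) (hg : R T b c g) : R (S ∪ T) a c (f ≫ g) := by
  induction hf with
  | nil a => simpa using hg
  | cons S e f h ih =>
    have := R.cons _ e _ (ih hg)
    rw [Set.insert_union, Category.assoc]
    exact this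

theorem R.split {S : Set (Edge C)} {a b : C} {f : a ⟶ b} (hf : R S a b f)
    {c d : C} (e : c ⟶ d) (he : (⟨c, d, e⟩ : Edge C) ∈ S) :
    ∃ (S0 S1 : Set (Edge C)) (f0 : a ⟶ c) (f1 : d ⟶ b), R S0 a c f0 ∧ R S1 d b f1 ∧
      f = f0 ≫ e ≫ f1 ∧ S0 ⊆ S ∧ S1 ⊆ S := by
  induction hf with
  | nil a => exact absurd he (Set.notMem_empty _)
  | cons S e' f h ih =>
    rcases Set.mem_insert_iff.1 he with h1 | h1
    · cases h1
      exact ⟨∅, S, 𝟙 _, f, R.nil _, h, by simp, by simp, Set.subset_insert _ _⟩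
    · obtain ⟨S0, S1, f0, f1, h0, h1, h2, h3, h4⟩ := ih h1
      refine ⟨_, S1, _, f1, R.cons S0 e' f0 h0, h1, by simp [h2],
        Set.insert_subset_insert h3, h4.trans (Set.subset_insert _ _)⟩

def Loc (C : Type u) [Category.{v} C] : Prop :=
  ∀ (x : C) (f g : x ⟶ x), f ≫ f = f ∧ f ≫ g = g ≫ f

theorem right_ret (hC : Loc C) {T : Set (Edge C)} {b c : C} {y : b ⟶ c} (hy : R T b c y) :
    ∀ {S : Set (Edge C)} {a : C} {x : a ⟶ b}, R S a b x → T ⊆ S →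
      ∃ z : c ⟶ b, x = x ≫ y ≫ z := by
  induction hy with
  | nil b => intro S a x _ _; exact ⟨𝟙 _, by simp⟩
  | @cons b d c T e y h ih =>
    intro S a x hx hT
    have he : (⟨b, d, e⟩ : Edge C) ∈ S := hT (Set.mem_insert _ _)
    have hx' := hx.comp (R.single e)
    obtain ⟨z, hz⟩ := ih hx' (((Set.subset_insert _ _).trans hT).trans Set.subset_union_left)
    obtain ⟨S0, S1, f0, f1, h0, h1, h2, h3, h4⟩ := hx.split e he
    refine ⟨z ≫ f1, ?_⟩
    have hl := (hC _ (e ≫ f1) (𝟙 _)).1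
    have : x ≫ e ≫ f1 = x := by
      rw [h2]
      simp only [Category.assoc] at hl ⊢
      rw [hl]
    calc x = (x ≫ e) ≫ f1 := by rw [Category.assoc, this]
      _ = ((x ≫ e) ≫ y ≫ z) ≫ f1 := by rw [← hz]
      _ = _ := by simp

theorem right_loop (hC : Loc C) {S T : Set (Edge C)} {a b : C} {y : b ⟶ b} {x : a ⟶ b}
    (hx : R S a b x) (hy : R T b b y) (hT : T ⊆ S) : x ≫ y = x := by
  obtain ⟨z, hz⟩ := right_ret hC hy hx hT
  calc x ≫ y = (x ≫ y ≫ z) ≫ y := by rw [← hz]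
    _ = x ≫ y ≫ (z ≫ y) := by simp
    _ = x ≫ (y ≫ y) ≫ z := by rw [(hC _ z y).2]; simp
    _ = x := by rw [(hC _ y y).1, ← hz]

theorem left_ret (hC : Loc C) {S T : Set (Edge C)} {a b c : C} {y : a ⟶ b} (hy : R S a b y)
    {w : c ⟶ a} (hw : R T c a w) (hT : T ⊆ S) : ∃ z : a ⟶ c, y = z ≫ w ≫ y := by
  induction hw with
  | nil b => exact ⟨𝟙 _, by simp⟩
  | @cons c d a T e w h ih =>
    have he : (⟨c, d, e⟩ : Edge C) ∈ S := hT (Set.mem_insert _ _)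
    obtain ⟨z, hz⟩ := ih hy ((Set.subset_insert _ _).trans hT)
    obtain ⟨S0, S1, f0, f1, h0, h1, h2, h3, h4⟩ := hy.split e he
    refine ⟨z ≫ w ≫ f0, ?_⟩
    have hl := (hC _ (w ≫ f0 ≫ e) (𝟙 _)).1
    calc y = z ≫ (w ≫ f0 ≫ e) ≫ f1 := by simp only [Category.assoc]; rw [← h2]; exact hz
      _ = z ≫ ((w ≫ f0 ≫ e) ≫ (w ≫ f0 ≫ e)) ≫ f1 := by rw [hl]
      _ = (z ≫ w ≫ f0) ≫ (e ≫ w) ≫ (f0 ≫ e ≫ f1) := by simp only [Category.assoc]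
      _ = _ := by rw [← h2]

theorem left_loop (hC : Loc C) {S T : Set (Edge C)} {a b : C} {y : a ⟶ a} {x : a ⟶ b}
    (hx : R S a b x) (hy : R T a a y) (hT : T ⊆ S) : y ≫ x = x := by
  obtain ⟨z, hz⟩ := left_ret hC hx hy hT
  calc y ≫ x = y ≫ (z ≫ y ≫ x) := by rw [← hz]
    _ = (y ≫ z) ≫ y ≫ x := by simp
    _ = z ≫ (y ≫ y) ≫ x := by rw [(hC _ y z).2]; simp
    _ = x := by rw [(hC _ y y).1, ← hz]

theorem outside (P : C → Prop) {S : Set (Edge C)} {a b : C} {f : a ⟶ b} (hf : R S a b f)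
    (hP : ∀ s ∈ S, P s.2.1 → P s.1) (ha : ¬ P a) : ∀ s ∈ S, ¬ P s.1 ∧ ¬ P s.2.1 := by
  induction hf with
  | nil a => intro s hs; exact absurd hs (Set.notMem_empty _)
  | @cons a d c S e f h ih =>
    have hd : ¬ P d := fun h => ha (hP _ (Set.mem_insert _ _) h)
    intro s hs
    rcases Set.mem_insert_iff.1 hs with h1 | h1
    · subst h1; exact ⟨ha, hd⟩
    · exact ih (fun s hs => hP s (Set.mem_insert_of_mem _ hs)) hd s h1

theorem cut (P : C → Prop) {S : Set (Edge C)} {a b : C} {f : a ⟶ b} (hf : R S a b f)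
    (hP : ∀ s ∈ S, P s.2.1 → P s.1) (ha : P a) (hb : ¬ P b) :
    ∃ (c d : C) (e : c ⟶ d) (f0 : a ⟶ c) (f1 : d ⟶ b), (⟨c, d, e⟩ : Edge C) ∈ S ∧ P c ∧ ¬ P d ∧
      R {s ∈ S | P s.1 ∧ P s.2.1} a c f0 ∧ R {s ∈ S | ¬ P s.1 ∧ ¬ P s.2.1} d b f1 ∧
      f = f0 ≫ e ≫ f1 ∧ ∀ s ∈ S, P s.1 → ¬ P s.2.1 → s = ⟨c, d, e⟩ := by
  induction hf with
  | nil a => exact absurd ha hb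
  | @cons a d b S e f h ih =>
    have hP' : ∀ s ∈ S, P s.2.1 → P s.1 := fun s hs => hP s (Set.mem_insert_of_mem _ hs)
    by_cases hd : P d
    · obtain ⟨c', d', e', f0, f1, h1, h2, h3, h4, h5, h6, h7⟩ := ih hP' hd hb
      refine ⟨c', d', e', e ≫ f0, f1, Set.mem_insert_of_mem _ h1, h2, h3, ?_, ?_, by simp [h6], ?_⟩
      · convert R.cons _ e f0 h4 using 1
        ext s
        simp only [Set.mem_setOf_eq, Set.mem_insert_iff]
        constructor
        · rintro ⟨h | h, h'⟩
          · exact Or.inl h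
          · exact Or.inr ⟨h, h'⟩
        · rintro (h | h)
          · subst h; exact ⟨Or.inl rfl, ha, hd⟩
          · exact ⟨Or.inr h.1, h.2⟩
      · convert h5 using 1
        ext s
        simp only [Set.mem_setOf_eq, Set.mem_insert_iff]
        constructor
        · rintro ⟨h | h, h'⟩
          · subst h; exact absurd ha h'.1
          · exact ⟨h, h'⟩
        · rintro h
          exact ⟨Or.inr h.1, h.2⟩
      · intro s hs hs1 hs2
        rcases Set.mem_insert_iff.1 hs with h | h
        · subst h; exact absurd hd hs2
        · exact h7 s h hs1 hs2
    · have ho := outside P h hP' hd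
      refine ⟨a, d, e, 𝟙 a, f, Set.mem_insert _ _, ha, hd, ?_, ?_, by simp, ?_⟩
      · convert R.nil a using 1
        ext s
        simp only [Set.mem_setOf_eq, Set.mem_insert_iff, Set.mem_empty_iff_false, iff_false]
        rintro ⟨h | h, h'⟩
        · subst h; exact hd h'.2
        · exact (ho s h).1 h'.1
      · convert h using 1
        ext s
        simp only [Set.mem_setOf_eq, Set.mem_insert_iff]
        constructor
        · rintro ⟨h | h, h'⟩
          · subst h; exact absurd ha h'.1
          · exact h
        · intro h
          exact ⟨Or.inr h, ho s h⟩
      · intro s hs hs1 hs2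
        rcases Set.mem_insert_iff.1 hs with h | h
        · exact h
        · exact absurd hs1 (ho s h).1

theorem main [Finite (Edge C)] (hC : Loc C) (S : Set (Edge C)) :
    ∀ {a b : C} {x y : a ⟶ b}, R S a b x → R S a b y → x = y := by
  induction S using WellFoundedLT.induction with
  | ind S ih =>
  intro a b x y hx hy
  let P : C → Prop := fun w => ∃ (Z : Set (Edge C)) (z : w ⟶ a), Z ⊆ S ∧ R Z w a z
  by_cases hb : P b
  · obtain ⟨Z, z, hZ, hz⟩ := hb
    have h1 := right_loop hC hx (hz.comp hy) (Set.union_subset hZ subset_rfl)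
    have h2 := left_loop hC hy (hx.comp hz) (Set.union_subset subset_rfl hZ)
    rw [← h1, ← Category.assoc, h2]
  · have hP : ∀ s ∈ S, P s.2.1 → P s.1 := by
      rintro ⟨c, d, e⟩ hs ⟨Z, z, hZ, hz⟩
      exact ⟨_, _, Set.insert_subset hs hZ, R.cons Z e z hz⟩
    have ha : P a := ⟨∅, 𝟙 a, Set.empty_subset _, R.nil a⟩
    obtain ⟨c, d, e, f0, f1, h1, h2, h3, h4, h5, h6, h7⟩ := cut P hx hP ha hb
    obtain ⟨c', d', e', g0, g1, k1, k2, k3, k4, k5, k6, k7⟩ := cut P hy hP ha hb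
    have hE := h7 _ k1 k2 k3
    cases hE
    have e0 := ih _ (Set.ssubset_iff_exists.2 ⟨Set.sep_subset _ _, _, h1, fun h => h3 h.2.2⟩) h4 k4
    have e1 := ih _ (Set.ssubset_iff_exists.2 ⟨Set.sep_subset _ _, _, h1, fun h => h.2.1 h2⟩) h5 k5
    rw [h6, k6, e0, e1]

def unionMonoid (X : Type) : CommMonoid (Set X) where
  mul := fun s t => s ∪ t
  one := ∅
  mul_assoc := Set.union_assoc
  one_mul := Set.empty_union
  mul_one := Set.union_empty
  mul_comm := Set.union_comm

end SimonThm

/-- Simon's theorem (Brzozowski–Simon): a finite category divides a finite idempotent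
and commutative monoid if and only if each of its endomorphism monoids is idempotent
and commutative. -/
theorem finite_category_divides_idempotent_commutative_monoid_iff
    {C : Type} [Category C] [Fintype C] [∀ x y : C, Fintype (x ⟶ y)] :
    (∃ (M : Type) (_ : CommMonoid M) (_ : Fintype M),
      (∀ m : M, m * m = m) ∧
      ∃ K : ∀ x y : C, (x ⟶ y) → Set M,
        (∀ (x y : C) (f : x ⟶ y), (K x y f).Nonempty) ∧
        (∀ (x y z : C) (f : x ⟶ y) (g : y ⟶ z),
          ∀ m ∈ K x y f, ∀ n ∈ K y z g, m * n ∈ K x z (f ≫ g)) ∧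
        (∀ (x y : C) (f g : x ⟶ y), f ≠ g → K x y f ∩ K x y g = ∅))
    ↔ (∀ (x : C) (f g : x ⟶ x), f ≫ f = f ∧ f ≫ g = g ≫ f) := by
  constructor
  · rintro ⟨M, _, _, hM, K, hne, hmul, hdis⟩ x f g
    have key : ∀ (f g : x ⟶ x) (m : M), m ∈ K x x f → m ∈ K x x g → f = g := by
      intro f g m h1 h2
      by_contra h
      have : m ∈ K x x f ∩ K x x g := ⟨h1, h2⟩
      rw [hdis x x f g h] at this
      exact this
    obtain ⟨m, hm⟩ := hne x x f
    obtain ⟨n, hn⟩ := hne x x g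
    refine ⟨key _ _ m ?_ hm, key _ _ (m * n) (hmul _ _ _ _ _ m hm n hn) ?_⟩
    · have := hmul _ _ _ _ _ m hm m hm
      rwa [hM] at this
    · rw [mul_comm]
      exact hmul _ _ _ _ _ n hn m hm
  · intro hC
    obtain ⟨n, ⟨i⟩⟩ := Finite.exists_equiv_fin (SimonThm.Edge C)
    refine ⟨Set (Fin n), SimonThm.unionMonoid _, Fintype.ofFinite _, Set.union_self,
      fun x y f => {S | SimonThm.R (i ⁻¹' S) x y f}, ?_, ?_, ?_⟩
    · intro x y f
      refine ⟨i '' {⟨x, y, f⟩}, ?_⟩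
      change SimonThm.R _ _ _ _
      rw [Set.preimage_image_eq _ i.injective]
      exact SimonThm.R.single f
    · intro x y z f g S hS T hT
      exact SimonThm.R.comp (S := i ⁻¹' S) (T := i ⁻¹' T) hS hT
    · intro x y f g hfg
      rw [Set.eq_empty_iff_forall_notMem]
      rintro S ⟨h1, h2⟩
      exact hfg (SimonThm.main hC _ h1 h2)
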